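/- For every q ∈ K_q and r ∈ K_r one has φ(q,r) ≥ φ_r(r). If A_x(r) = 0 for some x then both sides equal +∞. If A_x(r) > 0 for all x, then φ_r(r) = φ(Q(r), r) and equality φ(q,r) = φ_r(r) holds if and only if q = Q(r); in particular φ_r(r) = min over q ∈ K_q of φ(q,r). -/

import Mathlib

noncomputable section

open Finset

variable {X Y J : Type*}

/-- `f(u,v) = u·log u − u·log v` with the conventions `f(0,v) = 0` and `f(u,0) = +∞` for `u > 0`,
taking values in the extended reals. -/
def fdiv (u v : ℝ) : EReal :=
  if u = 0 then 0
  else if v = 0 then (⊤ : EReal)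
  else ((u * Real.log u - u * Real.log v : ℝ) : EReal)

/-- Marginal `p_x := ∑_y p_{x,y}`. -/
def margX [Fintype Y] (p : X → Y → ℝ) (x : X) : ℝ := ∑ y, p x y

/-- Marginal `p^y := ∑_x p_{x,y}`. -/
def margY [Fintype X] (p : X → Y → ℝ) (y : Y) : ℝ := ∑ x, p x y

/-- The polytope `K_q`: `q_{j|x} ≥ 0`, `∑_{j∋x} q_{j|x} = 1` for every `x`,
and `q_{j|x} = 0` whenever `x ∉ j`. -/
def Kq [Fintype J] [DecidableEq X] (S : J → Finset X) : Set (J → X → ℝ) :=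
  {q | (∀ j x, 0 ≤ q j x) ∧ (∀ x, (∑ j, if x ∈ S j then q j x else 0) = 1) ∧
    (∀ j x, x ∉ S j → q j x = 0)}

/-- The polytope `K_r`: `r_{j|y} ≥ 0` and `∑_j r_{j|y} = 1` for every `y`. -/
def Kr (J Y : Type*) [Fintype J] : Set (J → Y → ℝ) :=
  {r | (∀ j y, 0 ≤ r j y) ∧ ∀ y, (∑ j, r j y) = 1}

/-- `φ(q,r) := ∑_{x,y,j} p_{x,y} · f(q_{j|x}, r_{j|y})`, extended-real valued. -/
def phi [Fintype X] [Fintype Y] [Fintype J] (p : X → Y → ℝ)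
    (q : J → X → ℝ) (r : J → Y → ℝ) : EReal :=
  ∑ x, ∑ y, ∑ j, (p x y : EReal) * fdiv (q j x) (r j y)

/-- `δ(q,q') := ∑_x p_x ∑_{j∋x} f(q_{j|x}, q'_{j|x})`, extended-real valued. -/
def delta [Fintype X] [Fintype Y] [Fintype J] [DecidableEq X] (p : X → Y → ℝ)
    (S : J → Finset X) (q q' : J → X → ℝ) : EReal :=
  ∑ x, (margX p x : EReal) * ∑ j, (if x ∈ S j then fdiv (q j x) (q' j x) else 0)

/-- `R_{j|y}(q) := ∑_{x∈j} p_{x|y} q_{j|x}`. -/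
def Rmap [Fintype X] [Fintype Y] [DecidableEq X] (p : X → Y → ℝ) (S : J → Finset X)
    (q : J → X → ℝ) : J → Y → ℝ :=
  fun j y => ∑ x, if x ∈ S j then (p x y / margY p y) * q j x else 0

/-- `A_x(r) := ∑_{j∋x} ∏_y (r_{j|y})^{p^{y|x}}` (real powers, with `0^0 = 1`). -/
def Afun [Fintype Y] [Fintype J] [DecidableEq X] (p : X → Y → ℝ) (S : J → Finset X)
    (r : J → Y → ℝ) (x : X) : ℝ :=
  ∑ j, if x ∈ S j then (∏ y, r j y ^ (p x y / margX p x)) else 0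

/-- `Q_{j|x}(r) := (∏_y (r_{j|y})^{p^{y|x}}) / A_x(r)` if `x ∈ j`, and `0` otherwise. -/
def Qmap [Fintype Y] [Fintype J] [DecidableEq X] (p : X → Y → ℝ) (S : J → Finset X)
    (r : J → Y → ℝ) : J → X → ℝ :=
  fun j x => if x ∈ S j then (∏ y, r j y ^ (p x y / margX p x)) / Afun p S r x else 0

open Classical in
/-- `φ_r(r) := −∑_x p_x log A_x(r)`, equal to `+∞` if `A_x(r) = 0` for some `x`. -/
def phiR [Fintype X] [Fintype Y] [Fintype J] [DecidableEq X] (p : X → Y → ℝ)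
    (S : J → Finset X) (r : J → Y → ℝ) : EReal :=
  if ∃ x, Afun p S r x = 0 then ⊤
  else (((- ∑ x, margX p x * Real.log (Afun p S r x)) : ℝ) : EReal)

/-- The explicit real-valued formula for `φ_q`:
`∑_x p_x ∑_{j∋x} q_{j|x} log q_{j|x} − ∑_y p^y ∑_j R_{j|y}(q) log R_{j|y}(q)`
(with the convention `0·log 0 = 0`, automatic since `Real.log 0 = 0`). -/
def phiQexp [Fintype X] [Fintype Y] [Fintype J] [DecidableEq X] (p : X → Y → ℝ)
    (S : J → Finset X) (q : J → X → ℝ) : ℝ :=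
  (∑ x, margX p x * ∑ j, if x ∈ S j then q j x * Real.log (q j x) else 0)
    - ∑ y, margY p y * ∑ j, Rmap p S q j y * Real.log (Rmap p S q j y)

/-- The convex corner `K_a := {a : 0 ≤ a_x ≤ A_x(r) (∀x) for some r ∈ K_r}`. -/
def Ka [Fintype X] [Fintype Y] [Fintype J] [DecidableEq X] (p : X → Y → ℝ)
    (S : J → Finset X) : Set (X → ℝ) :=
  {a | ∃ r ∈ Kr J Y, ∀ x, 0 ≤ a x ∧ a x ≤ Afun p S r x}

open Classical in
/-- `φ_a(a) := −∑_x p_x log a_x`, equal to `+∞` if `a_x = 0` for some `x`. -/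
def phiA [Fintype X] [Fintype Y] (p : X → Y → ℝ) (a : X → ℝ) : EReal :=
  if ∃ x, a x = 0 then ⊤
  else (((- ∑ x, margX p x * Real.log (a x)) : ℝ) : EReal)

theorem EReal.finset_sum_ne_bot {ι : Type*} (s : Finset ι) (f : ι → EReal)
    (h : ∀ i ∈ s, f i ≠ ⊥) : ∑ i ∈ s, f i ≠ ⊥ := by
  refine Finset.sum_induction f (· ≠ ⊥) (fun a b ha hb => ?_) (by simp) h
  exact EReal.add_ne_bot_iff.2 ⟨ha, hb⟩

theorem EReal.finset_sum_eq_top {ι : Type*} {s : Finset ι} {f : ι → EReal}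
    (h : ∀ i ∈ s, f i ≠ ⊥) {i : ι} (hi : i ∈ s) (hf : f i = ⊤) : ∑ i ∈ s, f i = ⊤ := by
  classical
  rw [← Finset.add_sum_erase s f hi, hf]
  exact EReal.top_add_of_ne_bot
    (EReal.finset_sum_ne_bot _ f fun k hk => h k (Finset.mem_of_mem_erase hk))

theorem EReal.coe_finset_sum {ι : Type*} (s : Finset ι) (f : ι → ℝ) :
    ((∑ i ∈ s, f i : ℝ) : EReal) = ∑ i ∈ s, (f i : EReal) :=
  map_sum (⟨⟨Real.toEReal, EReal.coe_zero⟩, EReal.coe_add⟩ : ℝ →+ EReal) f s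

theorem coe_mul_fdiv_ne_bot {c : ℝ} (hc : 0 ≤ c) (u v : ℝ) : (c : EReal) * fdiv u v ≠ ⊥ := by
  unfold fdiv
  split_ifs with hu hv
  · simp
  · rcases hc.eq_or_lt with rfl | hc
    · simp
    · simp [EReal.coe_mul_top_of_pos hc]
  · rw [← EReal.coe_mul]
    exact EReal.coe_ne_bot _

theorem coe_mul_fdiv {c u v : ℝ} (hc : 0 ≤ c) (h : 0 < c → v = 0 → u = 0) :
    (c : EReal) * fdiv u v = ((c * (u * Real.log u - u * Real.log v) : ℝ) : EReal) := by
  rcases hc.eq_or_lt with rfl | hc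
  · simp
  unfold fdiv
  split_ifs with hu hv
  · simp [hu]
  · exact absurd (h hc hv) hu
  · rw [← EReal.coe_mul]

/-- The pointwise Gibbs inequality. -/
theorem sub_le_mul_log_sub_log {u v : ℝ} (hu : 0 ≤ u) (hv : 0 ≤ v) (h : v = 0 → u = 0) :
    u - v ≤ u * (Real.log u - Real.log v) := by
  rcases hu.eq_or_lt with rfl | hu
  · simpa using hv
  have hv : 0 < v := hv.lt_of_ne fun h0 => hu.ne' (h h0.symm)
  have := mul_le_mul_of_nonneg_left (Real.log_le_sub_one_of_pos (div_pos hv hu)) hu.le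
  rw [Real.log_div hv.ne' hu.ne', mul_sub u (v / u), mul_div_cancel₀ _ hu.ne'] at this
  linarith

theorem sub_lt_mul_log_sub_log {u v : ℝ} (hu : 0 ≤ u) (hv : 0 ≤ v) (h : v = 0 → u = 0)
    (huv : u ≠ v) : u - v < u * (Real.log u - Real.log v) := by
  rcases hu.eq_or_lt with rfl | hu
  · simpa using hv.lt_of_ne huv
  have hv : 0 < v := hv.lt_of_ne fun h0 => hu.ne' (h h0.symm)
  have hne : v / u ≠ 1 := fun h1 => huv ((div_eq_one_iff_eq hu.ne').1 h1).symm
  have := mul_lt_mul_of_pos_left (Real.log_lt_sub_one_of_pos (div_pos hv hu) hne) hu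
  rw [Real.log_div hv.ne' hu.ne', mul_sub u (v / u), mul_div_cancel₀ _ hu.ne'] at this
  linarith

section

variable [Fintype X] [Fintype Y] [Fintype J] {p : X → Y → ℝ} {q : J → X → ℝ} {r : J → Y → ℝ}

theorem phi_eq_top (hp : ∀ x y, 0 ≤ p x y) {x : X} {y : Y} {j : J} (hxy : 0 < p x y)
    (hr : r j y = 0) (hq : q j x ≠ 0) : phi p q r = ⊤ := by
  have hj : ∀ x y, ∀ j ∈ (Finset.univ : Finset J), (p x y : EReal) * fdiv (q j x) (r j y) ≠ ⊥ :=
    fun x y j _ => coe_mul_fdiv_ne_bot (hp x y) _ _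
  have hy := fun x y => EReal.finset_sum_ne_bot _ _ (hj x y)
  have hx := fun x => EReal.finset_sum_ne_bot Finset.univ _ fun y _ => hy x y
  refine EReal.finset_sum_eq_top (fun x _ => hx x) (Finset.mem_univ x) ?_
  refine EReal.finset_sum_eq_top (fun y _ => hy x y) (Finset.mem_univ y) ?_
  refine EReal.finset_sum_eq_top (hj x y) (Finset.mem_univ j) ?_
  simp [fdiv, hr, hq, EReal.coe_mul_top_of_pos hxy]

theorem phi_eq_coe (hp : ∀ x y, 0 ≤ p x y)
    (h : ∀ x y j, 0 < p x y → r j y = 0 → q j x = 0) :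
    phi p q r = ((∑ x, ∑ y, ∑ j,
      p x y * (q j x * Real.log (q j x) - q j x * Real.log (r j y)) : ℝ) : EReal) := by
  simp only [phi, EReal.coe_finset_sum]
  exact Finset.sum_congr rfl fun x _ => Finset.sum_congr rfl fun y _ =>
    Finset.sum_congr rfl fun j _ => coe_mul_fdiv (hp x y) (h x y j)

end

section

variable [Fintype Y] {p : X → Y → ℝ}

theorem prod_rpow_nonneg {w v : Y → ℝ} (hw : ∀ y, 0 ≤ w y) : 0 ≤ ∏ y, w y ^ v y :=
  Finset.prod_nonneg fun y _ => Real.rpow_nonneg (hw y) _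

theorem rpow_div_margX_eq_zero_iff {x : X} (hpx : 0 < margX p x) (hp : ∀ y, 0 ≤ p x y) {y : Y} {t : ℝ}
    (ht : 0 ≤ t) : t ^ (p x y / margX p x) = 0 ↔ 0 < p x y ∧ t = 0 := by
  rw [Real.rpow_eq_zero_iff_of_nonneg ht, and_comm, Ne, div_eq_zero_iff, or_iff_left hpx.ne',
    (hp y).lt_iff_ne']

theorem exists_pos_of_prod_rpow_eq_zero {x : X} (hpx : 0 < margX p x) (hp : ∀ y, 0 ≤ p x y)
    {w : Y → ℝ} (hw : ∀ y, 0 ≤ w y) (h : ∏ y, w y ^ (p x y / margX p x) = 0) :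
    ∃ y, 0 < p x y ∧ w y = 0 := by
  obtain ⟨y, -, hy⟩ := Finset.prod_eq_zero_iff.1 h
  exact ⟨y, (rpow_div_margX_eq_zero_iff hpx hp (hw y)).1 hy⟩

theorem margX_mul_log_prod {x : X} (hpx : 0 < margX p x) {w : Y → ℝ} (hw : ∀ y, 0 ≤ w y)
    (h : ∏ y, w y ^ (p x y / margX p x) ≠ 0) :
    margX p x * Real.log (∏ y, w y ^ (p x y / margX p x)) = ∑ y, p x y * Real.log (w y) := by
  rw [Real.log_prod fun y hy => Finset.prod_ne_zero_iff.1 h y hy, Finset.mul_sum]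
  refine Finset.sum_congr rfl fun y hy => ?_
  rcases (hw y).eq_or_lt with h0 | h0
  · have := Finset.prod_ne_zero_iff.1 h y hy
    rw [← h0, Ne, Real.rpow_eq_zero_iff_of_nonneg le_rfl] at this
    have hp0 : p x y = 0 := by
      by_contra hne
      exact this ⟨rfl, div_ne_zero hne hpx.ne'⟩
    simp [hp0]
  · rw [Real.log_rpow h0]
    field_simp

variable [Fintype J] [DecidableEq X] {S : J → Finset X} {q : J → X → ℝ} {r : J → Y → ℝ}

theorem Afun_nonneg (hr : ∀ j y, 0 ≤ r j y) (x : X) : 0 ≤ Afun p S r x :=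
  Finset.sum_nonneg fun j _ => by
    split_ifs
    · exact prod_rpow_nonneg (hr j)
    · exact le_rfl

theorem Qmap_mem_Kq (hr : ∀ j y, 0 ≤ r j y) (hA : ∀ x, 0 < Afun p S r x) :
    Qmap p S r ∈ Kq S := by
  refine ⟨fun j x => ?_, fun x => ?_, fun j x hx => if_neg hx⟩
  · unfold Qmap
    split_ifs
    · exact div_nonneg (prod_rpow_nonneg (hr j)) (hA x).le
    · exact le_rfl
  · refine Eq.trans ?_ (div_self (hA x).ne')
    nth_rw 1 [Afun]
    rw [Finset.sum_div]
    refine Finset.sum_congr rfl fun j _ => ?_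
    by_cases h : x ∈ S j <;> simp [Qmap, h]

theorem sum_eq_one_of_mem_Kq (hq : q ∈ Kq S) (x : X) : ∑ j, q j x = 1 := by
  rw [← hq.2.1 x]
  refine Finset.sum_congr rfl fun j _ => ?_
  split_ifs with h
  · rfl
  · exact hq.2.2 j x h

theorem Qmap_eq_zero_iff (hA : ∀ x, 0 < Afun p S r x) {j : J} {x : X} (hx : x ∈ S j) :
    Qmap p S r j x = 0 ↔ ∏ y, r j y ^ (p x y / margX p x) = 0 := by
  simp [Qmap, hx, (hA x).ne']

theorem Qmap_eq_zero_of_pos (hpx : ∀ x, 0 < margX p x) {x : X} {y : Y} {j : J}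
    (hxy : 0 < p x y) (hr : r j y = 0) : Qmap p S r j x = 0 := by
  unfold Qmap
  split_ifs
  · rw [Finset.prod_eq_zero (Finset.mem_univ y), zero_div]
    rw [hr, Real.zero_rpow (div_pos hxy (hpx x)).ne']
  · rfl

theorem eq_zero_of_Qmap_eq_zero (hp : ∀ x y, 0 ≤ p x y) (hpx : ∀ x, 0 < margX p x)
    (hr : ∀ j y, 0 ≤ r j y) (hA : ∀ x, 0 < Afun p S r x) (hq : q ∈ Kq S)
    (h : ∀ x y j, 0 < p x y → r j y = 0 → q j x = 0) {j : J} {x : X}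
    (h0 : Qmap p S r j x = 0) : q j x = 0 := by
  by_cases hx : x ∈ S j
  · obtain ⟨y, hy, hry⟩ := exists_pos_of_prod_rpow_eq_zero (hpx x) (hp x) (hr j)
      ((Qmap_eq_zero_iff hA hx).1 h0)
    exact h x y j hy hry
  · exact hq.2.2 j x hx

variable [Fintype X]

/-- When it is finite, `φ(q,r)` exceeds `φ_r(r)` by the divergence of `q` from `Q(r)`. -/
theorem phi_eq_add_divergence (hp : ∀ x y, 0 ≤ p x y) (hpx : ∀ x, 0 < margX p x)
    (hr : ∀ j y, 0 ≤ r j y) (hA : ∀ x, 0 < Afun p S r x) (hq : q ∈ Kq S)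
    (h : ∀ x y j, 0 < p x y → r j y = 0 → q j x = 0) :
    phi p q r = ((-∑ x, margX p x * Real.log (Afun p S r x) + ∑ x, ∑ j, margX p x *
      (q j x * (Real.log (q j x) - Real.log (Qmap p S r j x)) - (q j x - Qmap p S r j x)) : ℝ) :
      EReal) := by
  rw [phi_eq_coe hp h, EReal.coe_eq_coe_iff, ← Finset.sum_neg_distrib, ← Finset.sum_add_distrib]
  refine Finset.sum_congr rfl fun x _ => ?_
  have key : ∀ j, ∑ y, p x y * (q j x * Real.log (q j x) - q j x * Real.log (r j y)) =
      margX p x * (q j x * (Real.log (q j x) - Real.log (Qmap p S r j x))) -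
        margX p x * Real.log (Afun p S r x) * q j x := by
    intro j
    by_cases hj : q j x = 0
    · simp [hj]
    have hx : x ∈ S j := by
      by_contra hx
      exact hj (hq.2.2 j x hx)
    have hw : ∏ y, r j y ^ (p x y / margX p x) ≠ 0 := fun h0 =>
      hj (eq_zero_of_Qmap_eq_zero hp hpx hr hA hq h ((Qmap_eq_zero_iff hA hx).2 h0))
    have hlog := margX_mul_log_prod (hpx x) (hr j) hw
    have hQ : Real.log (Qmap p S r j x) =
        Real.log (∏ y, r j y ^ (p x y / margX p x)) - Real.log (Afun p S r x) := by
      rw [Qmap, if_pos hx, Real.log_div hw (hA x).ne']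
    have hsum : ∑ y, p x y * (q j x * Real.log (q j x) - q j x * Real.log (r j y)) =
        margX p x * (q j x * Real.log (q j x)) - q j x * ∑ y, p x y * Real.log (r j y) := by
      rw [margX, Finset.sum_mul, Finset.mul_sum, ← Finset.sum_sub_distrib]
      exact Finset.sum_congr rfl fun y _ => by ring
    rw [hsum, ← hlog, hQ]
    ring
  rw [Finset.sum_comm, Finset.sum_congr rfl fun j _ => key j, Finset.sum_sub_distrib,
    ← Finset.mul_sum, ← Finset.mul_sum, ← Finset.mul_sum, Finset.sum_sub_distrib,
    Finset.sum_sub_distrib, sum_eq_one_of_mem_Kq hq, sum_eq_one_of_mem_Kq (Qmap_mem_Kq hr hA)]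
  ring

theorem phiR_of_pos (hA : ∀ x, 0 < Afun p S r x) :
    phiR p S r = ((-∑ x, margX p x * Real.log (Afun p S r x) : ℝ) : EReal) :=
  if_neg fun ⟨x, hx⟩ => (hA x).ne' hx

theorem phiR_eq_phi_Qmap (hp : ∀ x y, 0 ≤ p x y) (hpx : ∀ x, 0 < margX p x)
    (hr : ∀ j y, 0 ≤ r j y) (hA : ∀ x, 0 < Afun p S r x) :
    phiR p S r = phi p (Qmap p S r) r := by
  rw [phi_eq_add_divergence hp hpx hr hA (Qmap_mem_Kq hr hA)
    fun x y j hxy h0 => Qmap_eq_zero_of_pos hpx hxy h0, phiR_of_pos hA]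
  simp

theorem phiR_lt_phi (hp : ∀ x y, 0 ≤ p x y) (hpx : ∀ x, 0 < margX p x)
    (hr : ∀ j y, 0 ≤ r j y) (hA : ∀ x, 0 < Afun p S r x) (hq : q ∈ Kq S)
    (hne : q ≠ Qmap p S r) : phiR p S r < phi p q r := by
  by_cases h : ∀ x y j, 0 < p x y → r j y = 0 → q j x = 0
  · rw [phi_eq_add_divergence hp hpx hr hA hq h, phiR_of_pos hA, EReal.coe_lt_coe_iff]
    refine lt_add_of_pos_right _ ?_
    have hQ := (Qmap_mem_Kq (S := S) hr hA).1
    have hac := fun j x => eq_zero_of_Qmap_eq_zero (j := j) (x := x) hp hpx hr hA hq h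
    have hnn : ∀ x j, 0 ≤ margX p x * (q j x * (Real.log (q j x) -
        Real.log (Qmap p S r j x)) - (q j x - Qmap p S r j x)) := fun x j =>
      mul_nonneg (hpx x).le
        (sub_nonneg.2 (sub_le_mul_log_sub_log (hq.1 j x) (hQ j x) (hac j x)))
    obtain ⟨j, hj⟩ := Function.ne_iff.1 hne
    obtain ⟨x, hjx⟩ := Function.ne_iff.1 hj
    refine Finset.sum_pos' (fun x _ => Finset.sum_nonneg fun j _ => hnn x j)
      ⟨x, Finset.mem_univ x, Finset.sum_pos' (fun j _ => hnn x j) ⟨j, Finset.mem_univ j, ?_⟩⟩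
    exact mul_pos (hpx x)
      (sub_pos.2 (sub_lt_mul_log_sub_log (hq.1 j x) (hQ j x) (hac j x) hjx))
  · push Not at h
    obtain ⟨x, y, j, hxy, h0, hj⟩ := h
    rw [phi_eq_top hp hxy h0 hj, phiR_of_pos hA]
    exact EReal.coe_lt_top _

theorem phiR_le_phi_of_pos (hp : ∀ x y, 0 ≤ p x y) (hpx : ∀ x, 0 < margX p x)
    (hr : ∀ j y, 0 ≤ r j y) (hA : ∀ x, 0 < Afun p S r x) (hq : q ∈ Kq S) :
    phiR p S r ≤ phi p q r := by
  by_cases hQ : q = Qmap p S r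
  · exact (hQ ▸ phiR_eq_phi_Qmap hp hpx hr hA).le
  · exact (phiR_lt_phi hp hpx hr hA hq hQ).le

theorem phi_eq_top_of_Afun_eq_zero (hp : ∀ x y, 0 ≤ p x y) (hpx : ∀ x, 0 < margX p x)
    (hr : ∀ j y, 0 ≤ r j y) (hq : q ∈ Kq S) {x : X} (hA : Afun p S r x = 0) :
    phi p q r = ⊤ := by
  obtain ⟨j, -, hj⟩ := Finset.exists_ne_zero_of_sum_ne_zero
    ((sum_eq_one_of_mem_Kq hq x).trans_ne one_ne_zero)
  have hx : x ∈ S j := by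
    by_contra hx
    exact hj (hq.2.2 j x hx)
  have hw := (Finset.sum_eq_zero_iff_of_nonneg fun j _ => by
    split_ifs
    · exact prod_rpow_nonneg (hr j)
    · exact le_rfl).1 hA j (Finset.mem_univ j)
  rw [if_pos hx] at hw
  obtain ⟨y, hxy, h0⟩ := exists_pos_of_prod_rpow_eq_zero (hpx x) (hp x) (hr j) hw
  exact phi_eq_top hp hxy h0 hj

end

/-- for every `q ∈ K_q` and `r ∈ K_r`, `φ(q,r) ≥ φ_r(r)`. If `A_x(r) = 0` for some
`x`, both sides are `+∞`. If `A_x(r) > 0` for all `x`, then `φ_r(r) = φ(Q(r), r)`, equality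
`φ(q,r) = φ_r(r)` holds iff `q = Q(r)`, and `φ_r(r) = min_{q ∈ K_q} φ(q,r)`. -/
theorem Q_is_optimal (X Y J : Type*) [Fintype X] [Fintype Y] [Fintype J]
    [Nonempty X] [Nonempty Y] [DecidableEq X]
    (p : X → Y → ℝ) (S : J → Finset X)
    (hp : ∀ x y, 0 ≤ p x y) (hptot : ∑ x, ∑ y, p x y = 1)
    (hpx : ∀ x, 0 < margX p x) (hpy : ∀ y, 0 < margY p y)
    (hcov : ∀ x, ∃ j, x ∈ S j) :
    ∀ q ∈ Kq S, ∀ r ∈ Kr J Y,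
      phiR p S r ≤ phi p q r ∧
      ((∃ x, Afun p S r x = 0) → phi p q r = ⊤ ∧ phiR p S r = ⊤) ∧
      ((∀ x, 0 < Afun p S r x) →
        phiR p S r = phi p (Qmap p S r) r ∧
        (phi p q r = phiR p S r ↔ q = Qmap p S r) ∧
        IsLeast ((fun q' => phi p q' r) '' Kq S) (phiR p S r)) := by
  intro q hq r hr
  have htop : (∃ x, Afun p S r x = 0) → phi p q r = ⊤ ∧ phiR p S r = ⊤ := fun h =>
    ⟨h.elim fun x hx => phi_eq_top_of_Afun_eq_zero hp hpx hr.1 hq hx, if_pos h⟩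
  refine ⟨?_, htop, fun hA => ⟨phiR_eq_phi_Qmap hp hpx hr.1 hA, ⟨fun h => ?_, ?_⟩, ?_, ?_⟩⟩
  · by_cases h : ∃ x, Afun p S r x = 0
    · rw [(htop h).1]
      exact le_top
    · push Not at h
      exact phiR_le_phi_of_pos hp hpx hr.1
        (fun x => (Afun_nonneg hr.1 x).lt_of_ne' (h x)) hq
  · by_contra hne
    exact (phiR_lt_phi hp hpx hr.1 hA hq hne).ne' h
  · rintro rfl
    exact (phiR_eq_phi_Qmap hp hpx hr.1 hA).symm
  · exact ⟨_, Qmap_mem_Kq hr.1 hA, (phiR_eq_phi_Qmap hp hpx hr.1 hA).symm⟩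
  · rintro _ ⟨q', hq', rfl⟩
    exact phiR_le_phi_of_pos hp hpx hr.1 hA hq'
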